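/- arXiv:2408.08497 — 4 statements merged into one kernel-verified Lean document; each statement's English description precedes it below -/
import Mathlib

section
/- Let f : ℝⁿ × ℝᵐ → ℝⁿ, let X' ⊆ ℝⁿ and W' ⊆ ℝᵐ be sets, and let L_x, L_w ≥ 0 be such that ‖f(x₁,w₁) − f(x₂,w₂)‖ ≤ L_x·‖x₁ − x₂‖ + L_w·‖w₁ − w₂‖ for all x₁, x₂ ∈ X' and w₁, w₂ ∈ W'. Let ŵ ∈ W' and ε_w ≥ 0 satisfy ‖w − ŵ‖ ≤ ε_w for all w ∈ W'. Let S ⊆ X' be a set of sampled states and δ ≥ 0 be such that every x ∈ X' satisfies ‖x − x_l‖ ≤ δ for some x_l ∈ S. Let θ₁ be an n×n real matrix with nonnegative entries whose operator norm induced by the sup norms is at most L_x, and let θ₂ ∈ ℝⁿ. Set ϱ := 4·L_x·δ + 2·L_w·ε_w. If for all samples x_l, x_l̄ ∈ S one has, componentwise, |f(x_l,ŵ) − f(x_l̄,ŵ)| ≤ θ₁·|x_l − x_l̄| + θ₂ − ϱ·1_n, then for all x₁, x₂ ∈ X' and all w₁, w₂ ∈ W' one has, componentwise, |f(x₁,w₁)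 − f(x₂,w₂)| ≤ θ₁·|x₁ − x₂| + θ₂. (That is, any solution of the sampled scenario convex program, tightened by the margin ϱ, yields a valid growth bound over the whole cell X' × W'.) -/
/-- core soundness claim of Theorem 4.4 of the paper.
If the dynamics `f` are Lipschitz on the cell `X' × W'`, the samples `S ⊆ X'`
form a `δ`-cover of `X'`, the internal inputs in `W'` are within `ε_w` of the
center `wh ∈ W'`, the matrix `θ₁` has nonnegative entries and operator norm
(induced by the sup norms) at most `L_x`, and the scenario constraints hold on
all sample pairs with margin `ϱ := 4·L_x·δ + 2·L_w·ε_w`, then the robust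
growth-bound inequality holds on the whole cell. -/
theorem stmt1 {n m : ℕ} (f : (Fin n → ℝ) → (Fin m → ℝ) → (Fin n → ℝ))
    (X' : Set (Fin n → ℝ)) (W' : Set (Fin m → ℝ))
    (Lx Lw : ℝ) (hLx : 0 ≤ Lx) (hLw : 0 ≤ Lw)
    (hLip : ∀ x₁ ∈ X', ∀ x₂ ∈ X', ∀ w₁ ∈ W', ∀ w₂ ∈ W',
      ‖f x₁ w₁ - f x₂ w₂‖ ≤ Lx * ‖x₁ - x₂‖ + Lw * ‖w₁ - w₂‖)
    (wh : Fin m → ℝ) (hwh : wh ∈ W') (εw : ℝ) (hεw : 0 ≤ εw)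
    (hW : ∀ w ∈ W', ‖w - wh‖ ≤ εw)
    (S : Set (Fin n → ℝ)) (hS : S ⊆ X') (δ : ℝ) (hδ : 0 ≤ δ)
    (hcov : ∀ x ∈ X', ∃ xl ∈ S, ‖x - xl‖ ≤ δ)
    (θ₁ : Matrix (Fin n) (Fin n) ℝ) (hθ₁nn : ∀ i j, 0 ≤ θ₁ i j)
    (hθ₁op : ∀ v : Fin n → ℝ, ‖θ₁.mulVec v‖ ≤ Lx * ‖v‖)
    (θ₂ : Fin n → ℝ)
    (ϱ : ℝ) (hϱ : ϱ = 4 * Lx * δ + 2 * Lw * εw)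
    (hSCP : ∀ xl ∈ S, ∀ xl' ∈ S, ∀ i,
      |f xl wh i - f xl' wh i| ≤
        θ₁.mulVec (fun j => |xl j - xl' j|) i + θ₂ i - ϱ) :
    ∀ x₁ ∈ X', ∀ x₂ ∈ X', ∀ w₁ ∈ W', ∀ w₂ ∈ W', ∀ i,
      |f x₁ w₁ i - f x₂ w₂ i| ≤
        θ₁.mulVec (fun j => |x₁ j - x₂ j|) i + θ₂ i := by
  intro x₁ hx₁ x₂ hx₂ w₁ hw₁ w₂ hw₂ i
  obtain ⟨y₁, hy₁, hxy₁⟩ := hcov x₁ hx₁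
  obtain ⟨y₂, hy₂, hxy₂⟩ := hcov x₂ hx₂
  have hf : ∀ x ∈ X', ∀ w ∈ W', ∀ y ∈ S, ‖x - y‖ ≤ δ →
      |f x w i - f y wh i| ≤ Lx * δ + Lw * εw := by
    intro x hx w hw y hy hxy
    calc |f x w i - f y wh i| ≤ ‖f x w - f y wh‖ := norm_le_pi_norm (f x w - f y wh) i
      _ ≤ Lx * ‖x - y‖ + Lw * ‖w - wh‖ := hLip x hx y (hS hy) w hw wh hwh
      _ ≤ Lx * δ + Lw * εw := by
        gcongr
        exact hW w hw
  have hf₁ := hf x₁ hx₁ w₁ hw₁ y₁ hy₁ hxy₁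
  have hf₂ := hf x₂ hx₂ w₂ hw₂ y₂ hy₂ hxy₂
  have hdist : ‖(fun j => |y₁ j - y₂ j|) - fun j => |x₁ j - x₂ j|‖ ≤ 2 * δ := by
    refine (pi_norm_le_iff_of_nonneg (by positivity)).2 fun j => ?_
    have h₁ : |x₁ j - y₁ j| ≤ δ := (norm_le_pi_norm (x₁ - y₁) j).trans hxy₁
    have h₂ : |x₂ j - y₂ j| ≤ δ := (norm_le_pi_norm (x₂ - y₂) j).trans hxy₂
    have h₃ := abs_abs_sub_abs_le_abs_sub (y₁ j - y₂ j) (x₁ j - x₂ j)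
    have h₄ : |(y₁ j - y₂ j) - (x₁ j - x₂ j)| ≤ 2 * δ := by
      rw [abs_le] at *
      constructor <;> linarith
    exact h₃.trans h₄
  have hθ : θ₁.mulVec (fun j => |y₁ j - y₂ j|) i - θ₁.mulVec (fun j => |x₁ j - x₂ j|) i
      ≤ Lx * (2 * δ) := by
    rw [← Pi.sub_apply, ← Matrix.mulVec_sub]
    calc _ ≤ _ := le_abs_self _
      _ ≤ _ := norm_le_pi_norm (θ₁.mulVec _) i
      _ ≤ _ := hθ₁op _
      _ ≤ _ := by gcongr
  have hs := hSCP y₁ hy₁ y₂ hy₂ i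
  rw [abs_le] at hf₁ hf₂ hs ⊢
  constructor <;> linarith
end

section
/- Let M : ℝⁿ → ℝᵐ be Lipschitz with constant L_M ≥ 0 with respect to the sup norms, let M̄ be an m×n real matrix, and let ρ_x ∈ ℝⁿ and ρ_w ∈ ℝᵐ have positive entries. Let x, x_l ∈ ℝⁿ with |x − x_l| ≤ ρ_x componentwise, set w_l := M(x_l), and define ε := L_M·‖ρ_x‖ + ‖w_l − M̄x‖. Then M(x) ∈ Φ_{ε·1_m}(M̄x), and consequently, for every ŵ ∈ ℝᵐ with |M(x) − ŵ| ≤ ρ_w componentwise, the hyper-intervals Φ_{ρ_w}(ŵ) and Φ_{ε·1_m}(M̄x) have nonempty intersection (both contain the point M(x)). -/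
/-- core of Theorem 4.7 of the paper.
If `M` is Lipschitz with constant `L_M ≥ 0` w.r.t. the sup norms and
`|x − x_l| ≤ ρ_x` componentwise with `w_l := M x_l`, then with
`ε := L_M·‖ρ_x‖ + ‖w_l − M̄x‖` the true value `M x` lies in the hyper-interval
`Φ_{ε·1_m}(M̄x)`; consequently, for every grid point `wh` whose cell
`Φ_{ρ_w}(wh)` contains `M x`, the cells `Φ_{ρ_w}(wh)` and `Φ_{ε·1_m}(M̄x)`
intersect (both contain `M x`). -/
theorem stmt3 {n m : ℕ} (M : (Fin n → ℝ) → (Fin m → ℝ)) (LM : ℝ) (hLM : 0 ≤ LM)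
    (hLip : ∀ x y : Fin n → ℝ, ‖M x - M y‖ ≤ LM * ‖x - y‖)
    (Mbar : Matrix (Fin m) (Fin n) ℝ)
    (ρx : Fin n → ℝ) (hρx : ∀ i, 0 < ρx i)
    (ρw : Fin m → ℝ) (hρw : ∀ j, 0 < ρw j)
    (x xl : Fin n → ℝ) (hx : ∀ i, |x i - xl i| ≤ ρx i)
    (wl : Fin m → ℝ) (hwl : wl = M xl)
    (ε : ℝ) (hε : ε = LM * ‖ρx‖ + ‖wl - Mbar.mulVec x‖) :
    (∀ j, |M x j - Mbar.mulVec x j| ≤ ε) ∧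
      ∀ wh : Fin m → ℝ, (∀ j, |M x j - wh j| ≤ ρw j) →
        ({y : Fin m → ℝ | ∀ j, |y j - wh j| ≤ ρw j} ∩
          {y : Fin m → ℝ | ∀ j, |y j - Mbar.mulVec x j| ≤ ε}).Nonempty := by
  have hdist : ‖x - xl‖ ≤ ‖ρx‖ := by
    refine (pi_norm_le_iff_of_nonneg (norm_nonneg _)).2 fun i => ?_
    exact (hx i).trans ((le_abs_self _).trans (norm_le_pi_norm ρx i))
  have hnorm : ‖M x - Mbar.mulVec x‖ ≤ ε := by
    rw [hε, hwl]
    calc ‖M x - Mbar.mulVec x‖ ≤ ‖M x - M xl‖ + ‖M xl - Mbar.mulVec x‖ :=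
          norm_sub_le_norm_sub_add_norm_sub _ _ _
      _ ≤ LM * ‖ρx‖ + ‖M xl - Mbar.mulVec x‖ := by
          gcongr
          exact (hLip x xl).trans (mul_le_mul_of_nonneg_left hdist hLM)
  have hmem : ∀ j, |M x j - Mbar.mulVec x j| ≤ ε := fun j =>
    (norm_le_pi_norm (M x - Mbar.mulVec x) j).trans hnorm
  exact ⟨hmem, fun wh hwh => ⟨M x, hwh, hmem⟩⟩
end

section
/- Let U be a nonempty type, Û ⊆ U, W ⊆ ℝᵐ, and let f : ℝⁿ → U → ℝᵐ → ℝⁿ be a deterministic transition function. Let X̂ ⊆ ℝⁿ and Ŵ ⊆ ℝᵐ be sets of abstract grid points and η_x ∈ ℝⁿ, η_w ∈ ℝᵐ have positive entries. Assume: (coverage) every w ∈ W satisfies |w − ŵ| ≤ η_w/2 componentwise for some ŵ ∈ Ŵ. Let κ : ℝⁿ_{≥0} × X̂ × Û × Ŵ → ℝⁿ_{≥0} be monotone in its first argument (r ≤ r' componentwise implies κ(r,x̂,û,ŵ) ≤ κ(r',x̂,û,ŵ) componentwise) and a growth bound, i.e., for all x̂ ∈ X̂, û ∈ Û, ŵ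 ∈ Ŵ, all x₁, x₂ with |x₁ − x̂| ≤ η_x/2 and |x₂ − x̂| ≤ η_x/2 and all w₁, w₂ with |w₁ − ŵ| ≤ η_w/2 and |w₂ − ŵ| ≤ η_w/2, one has |f(x₁,û,w₁) − f(x₂,û,w₂)| ≤ κ(|x₁ − x₂|, x̂, û, ŵ) componentwise. Define the abstract transition map f̂(x̂,û,ŵ) := {x̂' ∈ X̂ : Φ_{q'}(f(x̂,û,ŵ)) ∩ Φ_{η_x/2}(x̂') ≠ ∅}, where q' := κ(η_x, x̂, û, ŵ). Then for every x ∈ ℝⁿ and x̂ ∈ X̂ with |x − x̂| ≤ η_x/2 and every w ∈ W, there exists ŵ ∈ Ŵ with |w − ŵ| ≤ η_w/2 such that for every û ∈ Û, every x̂' ∈ X̂ with |f(x,û,w) − x̂'| ≤ η_x/2 belongs to f̂(x̂,û,ŵ). In other words, the set-membership relation Q := {(x,x̂) : |x − x̂| ≤ η_x/2}, together with R := {(w,ŵ) : |w − ŵ| ≤ η_w/2}, is a feedback refinement relation from the concrete system to its finite abstraction (the admissible-input inclusion holds since f is a total function and the abstract transition above is nonempty whenever defined). -/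
/-- Theorem 4.2 of the paper: feedback refinement relation from
a concrete discrete-time control system to its growth-bound-based finite
abstraction. The abstract transition map is
`f̂(xh,uh,wh) := {xh' ∈ Xh : Φ_{q'}(f(xh,uh,wh)) ∩ Φ_{η_x/2}(xh') ≠ ∅}` with
`q' := κ(η_x,xh,uh,wh)`. For every concrete state `x` related to an abstract
state `xh` (i.e. `|x − xh| ≤ η_x/2`) and every internal input `w ∈ W`, there is
an abstract internal input `wh ∈ Wh` with `|w − wh| ≤ η_w/2` such that, for every
external input `uh ∈ Û`, every abstract state `xh'` related to the concrete
successor `f(x,uh,w)` belongs to `f̂(xh,uh,wh)`. -/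
theorem stmt4 {n m : ℕ} {U : Type*} [Nonempty U] (Uhat : Set U)
    (W : Set (Fin m → ℝ))
    (f : (Fin n → ℝ) → U → (Fin m → ℝ) → (Fin n → ℝ))
    (Xhat : Set (Fin n → ℝ)) (What : Set (Fin m → ℝ))
    (ηx : Fin n → ℝ) (ηw : Fin m → ℝ)
    (hηx : ∀ i, 0 < ηx i) (hηw : ∀ j, 0 < ηw j)
    (hcov : ∀ w ∈ W, ∃ wh ∈ What, ∀ j, |w j - wh j| ≤ ηw j / 2)
    (κ : (Fin n → ℝ) → (Fin n → ℝ) → U → (Fin m → ℝ) → (Fin n → ℝ))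
    (hκnn : ∀ r xh uh wh, (∀ i, 0 ≤ r i) → ∀ i, 0 ≤ κ r xh uh wh i)
    (hκmono : ∀ r r' xh uh wh, (∀ i, 0 ≤ r i) → (∀ i, r i ≤ r' i) →
      ∀ i, κ r xh uh wh i ≤ κ r' xh uh wh i)
    (hκgb : ∀ xh ∈ Xhat, ∀ uh ∈ Uhat, ∀ wh ∈ What,
      ∀ x₁ x₂ : Fin n → ℝ, (∀ i, |x₁ i - xh i| ≤ ηx i / 2) →
        (∀ i, |x₂ i - xh i| ≤ ηx i / 2) →
      ∀ w₁ w₂ : Fin m → ℝ, (∀ j, |w₁ j - wh j| ≤ ηw j / 2) →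
        (∀ j, |w₂ j - wh j| ≤ ηw j / 2) →
      ∀ i, |f x₁ uh w₁ i - f x₂ uh w₂ i| ≤ κ (fun j => |x₁ j - x₂ j|) xh uh wh i)
    (fhat : (Fin n → ℝ) → U → (Fin m → ℝ) → Set (Fin n → ℝ))
    (hfhat : ∀ xh uh wh, fhat xh uh wh =
      {xh' ∈ Xhat |
        ({y : Fin n → ℝ | ∀ i, |y i - f xh uh wh i| ≤ κ ηx xh uh wh i} ∩
          {y : Fin n → ℝ | ∀ i, |y i - xh' i| ≤ ηx i / 2}).Nonempty}) :
    ∀ x : Fin n → ℝ, ∀ xh ∈ Xhat, (∀ i, |x i - xh i| ≤ ηx i / 2) →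
    ∀ w ∈ W, ∃ wh ∈ What, (∀ j, |w j - wh j| ≤ ηw j / 2) ∧
      ∀ uh ∈ Uhat, ∀ xh' ∈ Xhat,
        (∀ i, |f x uh w i - xh' i| ≤ ηx i / 2) → xh' ∈ fhat xh uh wh := by
  intro x xh hxh hx w hw
  obtain ⟨wh, hwh, hwwh⟩ := hcov w hw
  refine ⟨wh, hwh, hwwh, fun uh huh xh' hxh' hsucc => ?_⟩
  rw [hfhat]
  refine ⟨hxh', f x uh w, fun i => ?_, hsucc⟩
  have hgrowth := hκgb xh hxh uh huh wh hwh x xh hx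
    (fun i => by simpa using (half_pos (hηx i)).le) w wh hwwh
    (fun j => by simpa using (half_pos (hηw j)).le) i
  exact hgrowth.trans (hκmono _ _ xh uh wh (fun j => abs_nonneg _)
    (fun j => (hx j).trans (half_le_self (hηx j).le)) i)
end

section
/- Let N ≥ 1 and for each i ∈ {1,…,N} let 𝒳ᵢ, X̂ᵢ, 𝒲ᵢ, Ŵᵢ, Uᵢ be nonempty types, fᵢ : 𝒳ᵢ → Uᵢ → 𝒲ᵢ → Set 𝒳ᵢ the (set-valued) transition map of the i-th concrete subsystem, and f̂ᵢ : X̂ᵢ → Uᵢ → Ŵᵢ → Set X̂ᵢ the transition map of its abstraction. Let M : (∏ᵢ 𝒳ᵢ) → (∏ᵢ 𝒲ᵢ) be the concrete interconnection map and M̂ : (∏ᵢ X̂ᵢ) → Set (∏ᵢ Ŵᵢ) the abstract interconnection map, and let Qᵢ ⊆ 𝒳ᵢ × X̂ᵢ and Rᵢ ⊆ 𝒲ᵢ × Ŵᵢ be relations. Assume: (H1) for each i, all (xᵢ, x̂ᵢ) ∈ Qᵢ and all (wᵢ, ŵᵢ) ∈ Rᵢ: (a) every uᵢ ∈ Uᵢ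 with f̂ᵢ(x̂ᵢ, uᵢ, ŵᵢ) ≠ ∅ also satisfies fᵢ(xᵢ, uᵢ, wᵢ) ≠ ∅, and (b) for every such uᵢ, every x'ᵢ ∈ fᵢ(xᵢ, uᵢ, wᵢ) and every x̂'ᵢ ∈ X̂ᵢ with (x'ᵢ, x̂'ᵢ) ∈ Qᵢ satisfy x̂'ᵢ ∈ f̂ᵢ(x̂ᵢ, uᵢ, ŵᵢ); (H2) for all x ∈ ∏ᵢ 𝒳ᵢ and x̂ ∈ ∏ᵢ X̂ᵢ with (xᵢ, x̂ᵢ) ∈ Qᵢ for all i: M̂(x̂) ≠ ∅ and for every ŵ ∈ M̂(x̂) and every i, ((M(x))ᵢ, ŵᵢ) ∈ Rᵢ. Define the interconnected transitions f(x, u) := {x' : ∀i, x'ᵢ ∈ fᵢ(xᵢ, uᵢ, (M(x))ᵢ)} and f̂(x̂, u) := ⋃_{ŵ ∈ M̂(x̂)} {x̂' : ∀i, x̂'ᵢ ∈ f̂ᵢ(x̂ᵢ, uᵢ, ŵᵢ)} for u ∈ ∏ᵢ Uᵢ. Then Q := {(x, x̂) : ∀i, (xᵢ, x̂ᵢ)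 ∈ Qᵢ} is a feedback refinement relation from the interconnected concrete system to the interconnected abstraction: for all (x, x̂) ∈ Q, (i) every u with f̂(x̂, u) ≠ ∅ also satisfies f(x, u) ≠ ∅, and (ii) for every such u, every x' ∈ f(x, u) and every x̂' with (x', x̂') ∈ Q satisfy x̂' ∈ f̂(x̂, u). -/
/-- Theorem 4.8 of the paper: compositionality.
Given feedback-refinement data `(Qᵢ, Rᵢ)` relating each concrete subsystem
`fᵢ` to its abstraction `f̂ᵢ`, and an abstraction `M̂` of the concrete
interconnection map `M`, the componentwise relation
`Q := {(x,xh) : ∀ i, Qᵢ (xᵢ) (xhᵢ)}` is a feedback refinement relation from the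
interconnected concrete system to the interconnected abstraction. -/
theorem stmt6 {N : ℕ} (hN : 1 ≤ N)
    (𝒳 Xh 𝒲 Wh U : Fin N → Type*)
    [∀ i, Nonempty (𝒳 i)] [∀ i, Nonempty (Xh i)] [∀ i, Nonempty (𝒲 i)]
    [∀ i, Nonempty (Wh i)] [∀ i, Nonempty (U i)]
    (f : ∀ i, 𝒳 i → U i → 𝒲 i → Set (𝒳 i))
    (fhat : ∀ i, Xh i → U i → Wh i → Set (Xh i))
    (M : (∀ i, 𝒳 i) → ∀ i, 𝒲 i)
    (Mhat : (∀ i, Xh i) → Set (∀ i, Wh i))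
    (Q : ∀ i, 𝒳 i → Xh i → Prop) (R : ∀ i, 𝒲 i → Wh i → Prop)
    (H1a : ∀ i, ∀ (x : 𝒳 i) (xh : Xh i) (w : 𝒲 i) (wh : Wh i),
      Q i x xh → R i w wh → ∀ u : U i,
        (fhat i xh u wh).Nonempty → (f i x u w).Nonempty)
    (H1b : ∀ i, ∀ (x : 𝒳 i) (xh : Xh i) (w : 𝒲 i) (wh : Wh i),
      Q i x xh → R i w wh → ∀ u : U i, (fhat i xh u wh).Nonempty →
        ∀ x' ∈ f i x u w, ∀ xh' : Xh i, Q i x' xh' → xh' ∈ fhat i xh u wh)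
    (H2 : ∀ (x : ∀ i, 𝒳 i) (xh : ∀ i, Xh i), (∀ i, Q i (x i) (xh i)) →
      (Mhat xh).Nonempty ∧ ∀ wh ∈ Mhat xh, ∀ i, R i (M x i) (wh i))
    (F : (∀ i, 𝒳 i) → (∀ i, U i) → Set (∀ i, 𝒳 i))
    (hF : ∀ x u, F x u = {x' | ∀ i, x' i ∈ f i (x i) (u i) (M x i)})
    (Fhat : (∀ i, Xh i) → (∀ i, U i) → Set (∀ i, Xh i))
    (hFhat : ∀ xh u, Fhat xh u =
      ⋃ wh ∈ Mhat xh, {xh' | ∀ i, xh' i ∈ fhat i (xh i) (u i) (wh i)}) :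
    ∀ (x : ∀ i, 𝒳 i) (xh : ∀ i, Xh i), (∀ i, Q i (x i) (xh i)) →
    ∀ u : ∀ i, U i, (Fhat xh u).Nonempty →
      (F x u).Nonempty ∧
      ∀ x' ∈ F x u, ∀ xh' : ∀ i, Xh i,
        (∀ i, Q i (x' i) (xh' i)) → xh' ∈ Fhat xh u := by
  intro x xh hQ u hne
  simp only [hFhat, hF] at hne ⊢
  obtain ⟨y, hy⟩ := hne
  simp only [Set.mem_iUnion, Set.mem_ofPred_eq, exists_prop] at hy ⊢
  obtain ⟨wh, hwh, hy⟩ := hy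
  have hR := (H2 x xh hQ).2 wh hwh
  constructor
  · choose z hz using fun i => H1a i _ _ _ _ (hQ i) (hR i) (u i) ⟨y i, hy i⟩
    exact ⟨z, hz⟩
  · exact fun x' hx' xh' hQ' => ⟨wh, hwh, fun i =>
      H1b i _ _ _ _ (hQ i) (hR i) (u i) ⟨y i, hy i⟩ _ (hx' i) _ (hQ' i)⟩
end
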